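/- Let n ≥ 2, let q ≥ 7 be a prime power with q ∉ {8,9,16,25,27,49}, and let c be a code word of C_{n-1}(n,q) with wt(c) ≤ min{(3q−6)θ_{n-2}+2, B_{n,q}}. Then every line of PG(n,q) intersects supp(c) in at most 2 or in at least q points. -/

import Mathlib

open scoped Classical

noncomputable section

namespace PGCode

open Projectivization

/-- The points of `PG(n, q)`, where the field `F` has order `q`. -/
abbrev Pt (F : Type) [Field F] (n : ℕ) := Projectivization F (Fin (n + 1) → F)

variable {F : Type} [Field F]

/-- A point of `PG(n,q)` lies in the projective subspace determined by a linear subspace `W`. -/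
def ptIn {n : ℕ} (P : Pt F n) (W : Submodule F (Fin (n + 1) → F)) : Prop :=
  Projectivization.submodule P ≤ W

/-- The set of points of the projective subspace determined by a linear subspace `W`. -/
def ptsIn {n : ℕ} (W : Submodule F (Fin (n + 1) → F)) : Set (Pt F n) :=
  {P | ptIn P W}

/-- The incidence vector (over `F_p = ZMod p`) of the projective subspace determined by `W`. -/
def incVec (p : ℕ) {n : ℕ} (W : Submodule F (Fin (n + 1) → F)) : Pt F n → ZMod p :=
  fun P => if ptIn P W then (1 : ZMod p) else 0

/-- The code `C_{n-1}(n,q)`: the `F_p`-span of the incidence vectors of all hyperplanes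
(projective dimension `n-1`, i.e. linear dimension `n`). -/
def code (F : Type) [Field F] (p n : ℕ) : Submodule (ZMod p) (Pt F n → ZMod p) :=
  Submodule.span (ZMod p)
    {v | ∃ W : Submodule F (Fin (n + 1) → F), Module.finrank F W = n ∧ v = incVec p W}

/-- The support of a word. -/
def supp {p n : ℕ} (v : Pt F n → ZMod p) : Set (Pt F n) := {P | v P ≠ 0}

/-- The weight of a word. -/
def wt {p n : ℕ} (v : Pt F n → ZMod p) : ℕ := (supp v).ncard

/-- The weight of the restriction of a word to the subspace determined by `W`. -/
def wtRes {p n : ℕ} (c : Pt F n → ZMod p) (W : Submodule F (Fin (n + 1) → F)) : ℕ :=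
  (ptsIn W ∩ supp c).ncard

/-- `θ_m = (q^(m+1) - 1)/(q - 1)`, with `θ_m = 0` for `m < 0`. -/
def theta (q : ℕ) (m : ℤ) : ℕ :=
  if m < 0 then 0 else ∑ i ∈ Finset.range (m.toNat + 1), q ^ i

/-- The bound `B_{n,q}` from the paper. -/
def B (n q : ℕ) : ℝ :=
  if q < 7 ∨ q = 8 ∨ q = 9 ∨ q = 16 ∨ q = 25 ∨ q = 27 ∨ q = 49 then
    2 * (q : ℝ) ^ (n - 1)
  else if q = 7 ∨ q = 11 ∨ q = 13 ∨ q = 17 then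
    (3 * q - Real.sqrt (6 * q) - 1 / 2) * (q : ℝ) ^ (n - 2)
  else if q = 19 ∨ q = 121 then
    (3 * q - Real.sqrt (6 * q) + 9 / 2) * (q : ℝ) ^ (n - 2)
  else if q = 29 ∨ q = 31 ∨ q = 32 then
    (4 * q - 4 * Real.sqrt q - 25 / 2) * (q : ℝ) ^ (n - 2)
  else
    (4 * q - Real.sqrt (8 * q) - 33 / 2) * (q : ℝ) ^ (n - 2)

/-- A line of `PG(n,q)`: a linear subspace of dimension `2`. -/
def IsLine {n : ℕ} (l : Submodule F (Fin (n + 1) → F)) : Prop := Module.finrank F l = 2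

/-- A plane of `PG(n,q)`: a linear subspace of dimension `3`. -/
def IsPlane {n : ℕ} (W : Submodule F (Fin (n + 1) → F)) : Prop := Module.finrank F W = 3

/-- The line `l` is an `α`-secant to `supp c`. -/
def secant {p n : ℕ} (c : Pt F n → ZMod p) (l : Submodule F (Fin (n + 1) → F)) (α : ℕ) : Prop :=
  IsLine l ∧ (ptsIn l ∩ supp c).ncard = α

/-- The restriction of `c` to the plane `W` is a linear combination of at most two lines of `W`. -/
def TwoLineComb (p : ℕ) {n : ℕ} (c : Pt F n → ZMod p) (W : Submodule F (Fin (n + 1) → F)) :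
    Prop :=
  ∃ l₁ l₂ : Submodule F (Fin (n + 1) → F), IsLine l₁ ∧ IsLine l₂ ∧ l₁ ≤ W ∧ l₂ ≤ W ∧
    ∃ a b : ZMod p, ∀ P : Pt F n, ptIn P W → c P = a * incVec p l₁ P + b * incVec p l₂ P

/-- Type `T^△`: the restriction of `c` to the plane `W` is a linear combination (with nonzero
coefficients) of three nonconcurrent lines of `W`. -/
def TypeTri (p : ℕ) {n : ℕ} (c : Pt F n → ZMod p) (W : Submodule F (Fin (n + 1) → F)) : Prop :=
  ∃ l₁ l₂ l₃ : Submodule F (Fin (n + 1) → F),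
    IsLine l₁ ∧ IsLine l₂ ∧ IsLine l₃ ∧ l₁ ≤ W ∧ l₂ ≤ W ∧ l₃ ≤ W ∧
    l₁ ≠ l₂ ∧ l₁ ≠ l₃ ∧ l₂ ≠ l₃ ∧
    (¬ ∃ P : Pt F n, ptIn P l₁ ∧ ptIn P l₂ ∧ ptIn P l₃) ∧
    ∃ a₁ a₂ a₃ : ZMod p, a₁ ≠ 0 ∧ a₂ ≠ 0 ∧ a₃ ≠ 0 ∧
      ∀ P : Pt F n, ptIn P W →
        c P = a₁ * incVec p l₁ P + a₂ * incVec p l₂ P + a₃ * incVec p l₃ P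

/-- Type `T^★`: the restriction of `c` to the plane `W` is a linear combination (with nonzero
coefficients) of three distinct concurrent lines of `W`. -/
def TypeStar (p : ℕ) {n : ℕ} (c : Pt F n → ZMod p) (W : Submodule F (Fin (n + 1) → F)) : Prop :=
  ∃ l₁ l₂ l₃ : Submodule F (Fin (n + 1) → F),
    IsLine l₁ ∧ IsLine l₂ ∧ IsLine l₃ ∧ l₁ ≤ W ∧ l₂ ≤ W ∧ l₃ ≤ W ∧
    l₁ ≠ l₂ ∧ l₁ ≠ l₃ ∧ l₂ ≠ l₃ ∧
    (∃ P : Pt F n, ptIn P l₁ ∧ ptIn P l₂ ∧ ptIn P l₃) ∧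
    ∃ a₁ a₂ a₃ : ZMod p, a₁ ≠ 0 ∧ a₂ ≠ 0 ∧ a₃ ≠ 0 ∧
      ∀ P : Pt F n, ptIn P W →
        c P = a₁ * incVec p l₁ P + a₂ * incVec p l₂ P + a₃ * incVec p l₃ P

/-- The base code word `c₀` of the `T^odd` construction on `PG(2,p)`:
`c₀(0,1,a) = a`, `c₀(1,0,b) = b`, `c₀(1,1,c) = -c`, and `c₀ = 0` elsewhere. -/
def oddBase (p : ℕ) [Fact p.Prime] : Pt (ZMod p) 2 → ZMod p := fun P =>
  if P.rep 0 = 0 ∧ P.rep 1 ≠ 0 then P.rep 2 / P.rep 1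
  else if P.rep 1 = 0 ∧ P.rep 0 ≠ 0 then P.rep 2 / P.rep 0
  else if P.rep 0 = P.rep 1 ∧ P.rep 0 ≠ 0 then -(P.rep 2 / P.rep 0)
  else 0

/-- The line `m : X₀ = 0` of `PG(2,p)`. -/
def lineM1 (p : ℕ) [Fact p.Prime] : Submodule (ZMod p) (Fin 3 → ZMod p) :=
  LinearMap.ker (LinearMap.proj 0 : (Fin 3 → ZMod p) →ₗ[ZMod p] ZMod p)

/-- The line `m' : X₁ = 0` of `PG(2,p)`. -/
def lineM2 (p : ℕ) [Fact p.Prime] : Submodule (ZMod p) (Fin 3 → ZMod p) :=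
  LinearMap.ker (LinearMap.proj 1 : (Fin 3 → ZMod p) →ₗ[ZMod p] ZMod p)

/-- The line `m'' : X₀ = X₁` of `PG(2,p)`. -/
def lineM3 (p : ℕ) [Fact p.Prime] : Submodule (ZMod p) (Fin 3 → ZMod p) :=
  LinearMap.ker ((LinearMap.proj 0 : (Fin 3 → ZMod p) →ₗ[ZMod p] ZMod p) - LinearMap.proj 1)

/-- The code word `d = (γ c₀ + λ m + λ' m' + λ'' m'')^π` of the `T^odd` construction, where the
collineation `π` of `PG(2,p)` is the inverse of the homography induced by the linear
equivalence `g`. -/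
def oddWord (p : ℕ) [Fact p.Prime] (g : (Fin 3 → ZMod p) ≃ₗ[ZMod p] (Fin 3 → ZMod p))
    (γ lam lam' lam'' : ZMod p) : Pt (ZMod p) 2 → ZMod p := fun P =>
  γ * oddBase p (Projectivization.map g.toLinearMap g.injective P) +
    lam * incVec p (lineM1 p) (Projectivization.map g.toLinearMap g.injective P) +
    lam' * incVec p (lineM2 p) (Projectivization.map g.toLinearMap g.injective P) +
    lam'' * incVec p (lineM3 p) (Projectivization.map g.toLinearMap g.injective P)

/-- The semilinear embedding of `PG(2,p)` onto the plane of `PG(n,q)` spanned by the linearly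
independent vectors `b 0, b 1, b 2`, relative to the field embedding `σ : F_p → F`. -/
def planeEmbed {n : ℕ} {p : ℕ} [Fact p.Prime] (σ : ZMod p →+* F)
    (b : Fin 3 → (Fin (n + 1) → F)) (hb : LinearIndependent F b) :
    Pt (ZMod p) 2 → Pt F n := fun P =>
  Projectivization.mk F (∑ i, σ (P.rep i) • b i) (by
    intro hzero
    have h0 : ∀ i ∈ Finset.univ, σ (P.rep i) = 0 :=
      linearIndependent_iff'.mp hb Finset.univ (fun i => σ (P.rep i)) hzero
    have h1 : P.rep = 0 := funext fun i => σ.injective (by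
      simp only [Pi.zero_apply, map_zero]; exact h0 i (Finset.mem_univ i))
    exact P.rep_nonzero h1)

/-- Type `T^odd`: this requires `q = p` to be prime (`|F| = p`), and `c` restricted to the plane
`W` (spanned by the frame `b`) must coincide, via a semilinear identification of `W` with
`PG(2,p)`, with a code word `d` of the `T^odd` construction. -/
def TypeOdd (p : ℕ) [Fact p.Prime] [Fintype F] {n : ℕ} (c : Pt F n → ZMod p)
    (W : Submodule F (Fin (n + 1) → F)) : Prop :=
  Fintype.card F = p ∧
  ∃ (σ : ZMod p →+* F) (b : Fin 3 → (Fin (n + 1) → F)) (hb : LinearIndependent F b),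
    Submodule.span F (Set.range b) = W ∧
    ∃ (g : (Fin 3 → ZMod p) ≃ₗ[ZMod p] (Fin 3 → ZMod p)) (γ lam lam' lam'' : ZMod p), γ ≠ 0 ∧
      ∀ Q : Pt (ZMod p) 2, c (planeEmbed σ b hb Q) = oddWord p g γ lam lam' lam'' Q

/-- The list of plane types `T_0, T_{q+1}, T_{2q}, T_{2q+1}, T^odd, T^△, T^★`. -/
inductive PlaneT : Type where
  | T0 | Tq1 | T2q | T2q1 | Todd | Ttri | Tstar
deriving DecidableEq

/-- The restriction of `c` to the plane `W` is a code word of the given type. -/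
def PlaneIsType (p q : ℕ) [Fact p.Prime] [Fintype F] {n : ℕ} (c : Pt F n → ZMod p)
    (W : Submodule F (Fin (n + 1) → F)) : PlaneT → Prop
  | .T0 => TwoLineComb p c W ∧ wtRes c W = 0
  | .Tq1 => TwoLineComb p c W ∧ wtRes c W = q + 1
  | .T2q => TwoLineComb p c W ∧ wtRes c W = 2 * q
  | .T2q1 => TwoLineComb p c W ∧ wtRes c W = 2 * q + 1
  | .Todd => TypeOdd p c W
  | .Ttri => TypeTri p c W
  | .Tstar => TypeStar p c W

/-- The plane `W` is of type `𝒯`. -/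
def TypeT (p q : ℕ) [Fact p.Prime] [Fintype F] {n : ℕ} (c : Pt F n → ZMod p)
    (W : Submodule F (Fin (n + 1) → F)) : Prop :=
  IsPlane W ∧ ∃ t : PlaneT, PlaneIsType p q c W t

/-- The plane `W` is of type `𝒪`. -/
def TypeO (p q : ℕ) [Fact p.Prime] [Fintype F] {n : ℕ} (c : Pt F n → ZMod p)
    (W : Submodule F (Fin (n + 1) → F)) : Prop :=
  IsPlane W ∧ ¬ TypeT p q c W

/-- The restriction of `c` to the `k`-space `Sp` (linear dimension `k+1`) is of type `t`:
there is a `(k-3)`-space `κ ⊆ Sp` on which `c` is a scalar multiple of the all-one function,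
a plane `π ⊆ Sp` of type `t` disjoint from `κ`, and `c P = c (⟨κ, P⟩ ∩ π)` for every point
`P` of `Sp` outside `κ`. -/
def SpaceIsType (p q : ℕ) [Fact p.Prime] [Fintype F] {n : ℕ} (c : Pt F n → ZMod p)
    (Sp : Submodule F (Fin (n + 1) → F)) (k : ℕ) (t : PlaneT) : Prop :=
  Module.finrank F Sp = k + 1 ∧
  ∃ κ : Submodule F (Fin (n + 1) → F), Module.finrank F κ = k - 2 ∧ κ ≤ Sp ∧
    (∃ a : ZMod p, ∀ P : Pt F n, ptIn P κ → c P = a) ∧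
    ∃ π : Submodule F (Fin (n + 1) → F), IsPlane π ∧ π ≤ Sp ∧ π ⊓ κ = ⊥ ∧
      PlaneIsType p q c π t ∧
      ∀ P : Pt F n, ptIn P Sp → ¬ ptIn P κ →
        ∃ Q : Pt F n, ptIn Q π ∧
          Projectivization.submodule Q ≤ κ ⊔ Projectivization.submodule P ∧ c P = c Q

section Hankel

open Polynomial Matrix

/-- If the specialisation at `y` of a polynomial matrix has rank at most `r`, then its determinant
vanishes at `y` with multiplicity at least `m - r`. -/
lemma pow_dvd_det_of_rank_le {K m : Type*} [Field K] [Fintype m] [DecidableEq m]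
    (M : Matrix m m K[X]) (y : K)
    (r : ℕ) (hr : (M.map (Polynomial.eval y)).rank ≤ r) :
    (X - C y) ^ (Fintype.card m - r) ∣ M.det := by
  obtain ⟨L, L', D, hD⟩ := Pivot.exists_list_transvec_mul_mul_list_transvec_eq_diagonal
    (M.map (Polynomial.eval y))
  set A := (L.map TransvectionStruct.toMatrix).prod with hA
  set A' := (L'.map TransvectionStruct.toMatrix).prod with hA'
  have hdA : A.det = 1 := TransvectionStruct.det_toMatrix_prod L
  have hdA' : A'.det = 1 := TransvectionStruct.det_toMatrix_prod L'
  have hcard : (Finset.univ.filter fun i => D i ≠ 0).card ≤ r := by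
    rw [← Fintype.card_subtype, ← Matrix.rank_diagonal, ← hD]
    refine le_trans ?_ hr
    exact (Matrix.rank_mul_le_left _ _).trans (Matrix.rank_mul_le_right _ _)
  set N : Matrix m m K[X] := A.map C * M * A'.map C with hN
  have hdetN : N.det = M.det := by
    have h1 : (A.map (C : K →+* K[X])).det = 1 := by
      rw [← RingHom.mapMatrix_apply, ← RingHom.map_det, hdA, map_one]
    have h2 : (A'.map (C : K →+* K[X])).det = 1 := by
      rw [← RingHom.mapMatrix_apply, ← RingHom.map_det, hdA', map_one]
    rw [hN, det_mul, det_mul, h1, h2, one_mul, mul_one]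
  have hev : N.map (Polynomial.eval y) = diagonal D := by
    have hc : ∀ E : Matrix m m K, (E.map (C : K →+* K[X])).map (evalRingHom y) = E := by
      intro E
      ext i j
      simp
    have : N.map (evalRingHom y) = A * M.map (evalRingHom y) * A' := by
      rw [hN, Matrix.map_mul, Matrix.map_mul, hc, hc]
    rw [← hD]
    exact this
  have hrow : ∀ i j, ∃ w : K[X], N i j = (if D i = 0 then X - C y else 1) * w := by
    intro i j
    split_ifs with h
    · have h0 : (N i j).eval y = 0 := by
        have := congrFun (congrFun hev i) j
        rw [Matrix.map_apply] at this
        rw [this]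
        by_cases hij : i = j
        · subst hij
          simp [h]
        · simp [hij]
      exact dvd_iff_isRoot.mpr h0
    · exact ⟨N i j, by simp⟩
  choose w hw using hrow
  have hNw : N = Matrix.of fun i j => (if D i = 0 then X - C y else 1) * w i j := by
    ext1 i j
    exact hw i j
  have hdet := Matrix.det_mul_column (fun i => if D i = 0 then X - C y else 1) (Matrix.of w)
  simp only [Matrix.of_apply] at hdet
  rw [← hdetN, hNw, hdet, Finset.prod_ite, Finset.prod_const_one, mul_one, Finset.prod_const]
  refine Dvd.dvd.mul_right (pow_dvd_pow _ ?_) _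
  have := Finset.card_filter_add_card_filter_not (s := (Finset.univ : Finset m)) (fun i => D i = 0)
  rw [Finset.card_univ] at this
  simp only [ne_eq] at hcard
  omega

lemma natDegree_det_hankel_le {K : Type*} [Field K] (Q : ℕ → K[X])
    (hQ : ∀ e, (Q e).natDegree ≤ e) (s : ℕ) :
    (Matrix.of fun i j : Fin s => Q (i + j)).det.natDegree ≤ s * (s - 1) := by
  rw [Matrix.det_apply]
  refine natDegree_sum_le_of_forall_le _ _ fun σ _ => ?_
  refine (natDegree_smul_le _ _).trans ((natDegree_prod_le _ _).trans ?_)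
  refine (Finset.sum_le_sum fun i _ => hQ _).trans (le_of_eq ?_)
  have h1 : ∑ i : Fin s, ((σ i : Fin s) : ℕ) = ∑ i : Fin s, (i : ℕ) :=
    Equiv.sum_comp σ fun i : Fin s => (i : ℕ)
  rw [Finset.sum_add_distrib, h1, ← mul_two, Fin.sum_univ_eq_sum_range (fun i => i),
    Finset.sum_range_id_mul_two]

/-- A stability inequality for functions on the affine plane whose moments along the lines
`y = const` are polynomials of bounded degree in `y`. -/
theorem card_mul_le_sum_of_moments {K : Type*} [Field K] [Fintype K] (f : K → K → K)
    (hf : ∀ e : ℕ, ∃ Q : K[X], Q.natDegree ≤ e ∧ ∀ y, Q.eval y = ∑ x, x ^ e * f x y)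
    (s : K → ℕ) (hs : ∀ y, s y = (Finset.univ.filter fun x => f x y ≠ 0).card) (y₀ : K) :
    Fintype.card K * s y₀ ≤ ∑ y, s y + s y₀ * (s y₀ - 1) := by
  choose Q hQd hQ using hf
  set M : Matrix (Fin (s y₀)) (Fin (s y₀)) K[X] := Matrix.of fun i j => Q (i + j) with hM
  have hrank : ∀ y, (M.map (Polynomial.eval y)).rank ≤ s y := by
    intro y
    let V : Matrix K (Fin (s y₀)) K := Matrix.of fun x i => x ^ (i : ℕ)
    have : M.map (Polynomial.eval y) = Vᵀ * (diagonal (fun x => f x y) * V) := by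
      ext i j
      rw [Matrix.mul_apply]
      simp only [hM, Matrix.map_apply, Matrix.of_apply, hQ, Matrix.transpose_apply,
        Matrix.diagonal_mul, V]
      exact Finset.sum_congr rfl fun x _ => by ring
    rw [this]
    refine (Matrix.rank_mul_le_right _ _).trans ((Matrix.rank_mul_le_left _ _).trans ?_)
    rw [Matrix.rank_diagonal, Fintype.card_subtype, hs]
  have hdet : M.det ≠ 0 := by
    intro h0
    set T := Finset.univ.filter fun x => f x y₀ ≠ 0 with hT
    have hcard : T.card = s y₀ := (hs y₀).symm
    let e : Fin (s y₀) ≃ T := (finCongr hcard.symm).trans T.equivFin.symm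
    let v : Fin (s y₀) → K := fun i => (e i : K)
    have hv : Function.Injective v := fun i j h => e.injective (Subtype.ext h)
    have hev : M.map (Polynomial.eval y₀) =
        (vandermonde v)ᵀ * (diagonal (fun i => f (v i) y₀) * vandermonde v) := by
      ext i j
      rw [Matrix.mul_apply]
      simp only [hM, Matrix.map_apply, Matrix.of_apply, hQ,
        Matrix.transpose_apply, Matrix.diagonal_mul, Matrix.vandermonde_apply, v]
      rw [Equiv.sum_comp e (fun t : T => (t : K) ^ (i : ℕ) * (f t y₀ * (t : K) ^ (j : ℕ))),
        Finset.sum_coe_sort T (fun t : K => t ^ (i : ℕ) * (f t y₀ * t ^ (j : ℕ)))]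
      symm
      rw [Finset.sum_subset (Finset.subset_univ T)]
      · exact Finset.sum_congr rfl fun x _ => by ring
      · intro x _ hx
        have : f x y₀ = 0 := by simpa [hT] using hx
        simp [this]
    have h1 : (M.map (Polynomial.eval y₀)).det = 0 := by
      have := RingHom.map_det (evalRingHom y₀) M
      rw [h0, map_zero] at this
      exact this.symm
    rw [hev, det_mul, det_mul, det_transpose, det_diagonal] at h1
    have hV := det_vandermonde_ne_zero_iff.mpr hv
    have hP : ∏ i, f (v i) y₀ ≠ 0 := Finset.prod_ne_zero_iff.mpr fun i _ => by
      exact (Finset.mem_filter.mp (e i).2).2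
    exact mul_ne_zero hV (mul_ne_zero hP hV) h1
  have hdvd : ∏ y : K, (X - C y) ^ (s y₀ - s y) ∣ M.det := by
    refine Finset.prod_dvd_of_coprime ?_ fun y _ => ?_
    · intro a _ b _ hab
      exact (pairwise_coprime_X_sub_C (s := fun z : K => z) (fun _ _ h => h) hab).pow
    · simpa using pow_dvd_det_of_rank_le M y (s y) (hrank y)
  have hdeg := (natDegree_le_of_dvd hdvd hdet).trans (natDegree_det_hankel_le Q hQd (s y₀))
  rw [natDegree_prod_of_monic _ _ fun y _ => (monic_X_sub_C y).pow _] at hdeg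
  simp only [natDegree_pow, natDegree_X_sub_C, mul_one] at hdeg
  have : Fintype.card K * s y₀ ≤ ∑ y, s y + ∑ y, (s y₀ - s y) := by
    rw [← Finset.sum_add_distrib, ← Finset.card_univ, ← smul_eq_mul, ← Finset.sum_const]
    exact Finset.sum_le_sum fun y _ => by omega
  omega

end Hankel

section VectorFunction

variable {n p : ℕ}

/-- The function on vectors induced by a word, with value `0` at the zero vector. -/
def vecFun (c : Pt F n → ZMod p) (v : Fin (n + 1) → F) : ZMod p :=
  if h : v ≠ 0 then c (Projectivization.mk F v h) else 0

lemma vecFun_of_ne (c : Pt F n → ZMod p) {v : Fin (n + 1) → F} (h : v ≠ 0) :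
    vecFun c v = c (Projectivization.mk F v h) := dif_pos h

lemma vecFun_zero (c : Pt F n → ZMod p) : vecFun c 0 = 0 := by simp [vecFun]

lemma vecFun_smul (c : Pt F n → ZMod p) {t : F} (ht : t ≠ 0) (v : Fin (n + 1) → F) :
    vecFun c (t • v) = vecFun c v := by
  by_cases hv : v = 0
  · simp [hv]
  · rw [vecFun_of_ne c (smul_ne_zero ht hv), vecFun_of_ne c hv]
    congr 1
    exact (Projectivization.mk_eq_mk_iff' F _ _ _ _).mpr ⟨t, rfl⟩

/-- The cone of nonzero vectors over the support of a word. -/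
def suppCone (c : Pt F n → ZMod p) : Set (Fin (n + 1) → F) := {v | vecFun c v ≠ 0}

lemma mem_suppCone {c : Pt F n → ZMod p} {v : Fin (n + 1) → F} :
    v ∈ suppCone c ↔ vecFun c v ≠ 0 := Iff.rfl

lemma ptIn_mk {v : Fin (n + 1) → F} (hv : v ≠ 0) (W : Submodule F (Fin (n + 1) → F)) :
    ptIn (Projectivization.mk F v hv) W ↔ v ∈ W := by
  rw [ptIn, Projectivization.submodule_mk, Submodule.span_singleton_le_iff_mem]

open Polynomial in
lemma exists_moment_polynomial_of_linear [Fintype F] (α β γ : F) (e : ℕ) :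
    ∃ Q : F[X], Q.natDegree ≤ e ∧
      ∀ y, Q.eval y = ∑ x : F, x ^ e * (if x * α + y * β + γ = 0 then 1 else 0) := by
  by_cases hα : α = 0
  · by_cases he : e < Fintype.card F - 1
    · refine ⟨0, by simp, fun y => ?_⟩
      simp only [hα, mul_zero, zero_add, ← Finset.sum_mul,
        FiniteField.sum_pow_lt_card_sub_one F e he, zero_mul, eval_zero]
    · refine ⟨C (∑ x : F, x ^ e) * (1 - (C β * X + C γ) ^ (Fintype.card F - 1)), ?_, fun y => ?_⟩
      · refine le_trans (natDegree_C_mul_le _ _) ?_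
        refine (natDegree_sub_le _ _).trans ?_
        rw [natDegree_one, max_eq_right (Nat.zero_le _)]
        refine natDegree_pow_le.trans (le_trans ?_ (not_lt.mp he))
        have := natDegree_linear_le (a := β) (b := γ)
        nlinarith
      · have hq : Fintype.card F - 1 ≠ 0 := by
          have := Fintype.one_lt_card (α := F)
          omega
        simp only [eval_mul, eval_C, eval_sub, eval_one, eval_pow, eval_add, eval_X, hα, mul_zero,
          zero_add, ← Finset.sum_mul]
        congr 1
        rw [mul_comm y β]
        split_ifs with h
        · rw [h, zero_pow hq, sub_zero]
        · rw [FiniteField.pow_card_sub_one_eq_one _ h, sub_self]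
  · refine ⟨(C (-β / α) * X + C (-γ / α)) ^ e, ?_, fun y => ?_⟩
    · refine natDegree_pow_le.trans ?_
      have := natDegree_linear_le (a := -β / α) (b := -γ / α)
      nlinarith
    · have hx : ∀ x : F, x * α + y * β + γ = 0 ↔ x = -β / α * y + -γ / α := by
        intro x
        constructor
        · intro h
          field_simp
          linear_combination h
        · rintro rfl
          field_simp
          ring
      simp only [hx, mul_ite, mul_one, mul_zero, Finset.sum_ite_eq', Finset.mem_univ, if_true,
        eval_pow, eval_add, eval_mul, eval_C, eval_X]

open Polynomial in
/-- The moments of a code word along parallel lines of an affine plane are polynomials of bounded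
degree. -/
lemma exists_moment_polynomial [Fintype F] [CharP F p] {c : Pt F n → ZMod p} (hc : c ∈ code F p n)
    {a d v : Fin (n + 1) → F} (h : ∀ x y : F, x • a + y • d + v ≠ 0) (e : ℕ) :
    ∃ Q : F[X], Q.natDegree ≤ e ∧ ∀ y, Q.eval y =
      ∑ x : F, x ^ e * ZMod.castHom (dvd_refl p) F (vecFun c (x • a + y • d + v)) := by
  induction hc using Submodule.span_induction with
  | mem c hc =>
    obtain ⟨W, hW, rfl⟩ := hc
    obtain ⟨φ, hφ, hle⟩ := W.exists_le_ker_of_lt_top (lt_top_iff_ne_top.mpr (by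
      rintro rfl
      simp at hW))
    have hker : W = LinearMap.ker φ := by
      refine Submodule.eq_of_le_of_finrank_eq hle ?_
      have := Module.Dual.finrank_ker_add_one_of_ne_zero hφ
      simp only [Module.finrank_fin_fun] at this
      omega
    obtain ⟨Q, hQ, hQe⟩ := exists_moment_polynomial_of_linear (φ a) (φ d) (φ v) e
    refine ⟨Q, hQ, fun y => (hQe y).trans (Finset.sum_congr rfl fun x _ => ?_)⟩
    rw [vecFun_of_ne _ (h x y), incVec]
    simp only [ptIn_mk, hker, LinearMap.mem_ker, map_add, map_smul, smul_eq_mul]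
    split_ifs <;> simp
  | zero => exact ⟨0, by simp, fun y => by simp [vecFun]⟩
  | add c c' _ _ ih ih' =>
    obtain ⟨Q, hQ, hQe⟩ := ih
    obtain ⟨Q', hQ', hQe'⟩ := ih'
    refine ⟨Q + Q', natDegree_add_le_of_degree_le hQ hQ', fun y => ?_⟩
    rw [eval_add, hQe, hQe', ← Finset.sum_add_distrib]
    refine Finset.sum_congr rfl fun x _ => ?_
    rw [vecFun_of_ne _ (h x y), vecFun_of_ne _ (h x y), vecFun_of_ne _ (h x y), Pi.add_apply,
      map_add, mul_add]
  | smul t c _ ih =>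
    obtain ⟨Q, hQ, hQe⟩ := ih
    refine ⟨C (ZMod.castHom (dvd_refl p) F t) * Q, (natDegree_C_mul_le _ _).trans hQ, fun y => ?_⟩
    rw [eval_mul, eval_C, hQe, Finset.mul_sum]
    refine Finset.sum_congr rfl fun x _ => ?_
    rw [vecFun_of_ne _ (h x y), vecFun_of_ne _ (h x y), Pi.smul_apply, smul_eq_mul, map_mul]
    ring

lemma card_filter_mem_suppCone [Fintype F] (c : Pt F n → ZMod p)
    (W : Submodule F (Fin (n + 1) → F)) :
    (Finset.univ.filter fun v => v ∈ W ∧ v ∈ suppCone c).card =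
      (Fintype.card F - 1) * (ptsIn W ∩ supp c).ncard := by
  have : Fintype (Pt F n) := Fintype.ofFinite _
  have hunits : (Finset.univ.filter fun t : F => t ≠ 0).card = Fintype.card F - 1 := by
    rw [Finset.filter_ne' Finset.univ (0 : F), Finset.card_erase_of_mem (Finset.mem_univ _),
      Finset.card_univ]
  rw [Set.ncard_eq_toFinset_card', ← hunits, ← Finset.card_product]
  symm
  have hmk : ∀ (t : F) (P : Pt F n) (h : t • P.rep ≠ 0), Projectivization.mk F _ h = P := by
    intro t P h
    conv_rhs => rw [← P.mk_rep]
    exact (Projectivization.mk_eq_mk_iff' F _ _ _ _).mpr ⟨t, rfl⟩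
  refine Finset.card_bij (fun x _ => x.1 • x.2.rep) ?_ ?_ ?_
  · rintro ⟨t, P⟩ h
    simp only [Finset.mem_product, Finset.mem_filter, Finset.mem_univ, true_and,
      Set.mem_toFinset, mem_suppCone] at h ⊢
    have h0 : t • P.rep ≠ 0 := smul_ne_zero h.1 P.rep_nonzero
    rw [vecFun_of_ne c h0, ← ptIn_mk h0, hmk]
    exact h.2
  · rintro ⟨t, P⟩ h ⟨t', P'⟩ h' heq
    simp only [Finset.mem_product, Finset.mem_filter, Finset.mem_univ, true_and] at h h' heq
    have h0 : t • P.rep ≠ 0 := smul_ne_zero h.1 P.rep_nonzero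
    have h0' : t' • P'.rep ≠ 0 := smul_ne_zero h'.1 P'.rep_nonzero
    obtain rfl : P = P' := by
      rw [← hmk t P h0, ← hmk t' P' h0']
      simp only [heq]
    rw [smul_left_injective F P.rep_nonzero heq]
  · intro v hv
    simp only [Finset.mem_filter, Finset.mem_univ, true_and, mem_suppCone] at hv
    have h0 : v ≠ 0 := by
      rintro rfl
      exact hv.2 (vecFun_zero c)
    obtain ⟨t, ht⟩ := Projectivization.exists_smul_eq_mk_rep F v h0
    refine ⟨((t⁻¹ : Fˣ), Projectivization.mk F v h0), ?_, ?_⟩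
    · simp only [Finset.mem_product, Finset.mem_filter, Finset.mem_univ, true_and,
        Set.mem_toFinset]
      refine ⟨Units.ne_zero _, (ptIn_mk h0 W).mpr hv.1, ?_⟩
      change c _ ≠ 0
      rw [← vecFun_of_ne c h0]
      exact hv.2
    · change (t⁻¹ : Fˣ) • (Projectivization.mk F v h0).rep = v
      rw [← ht, inv_smul_smul]

end VectorFunction
section Frames

variable {V : Type} [AddCommGroup V] [Module F V]

/-- The vectors `a` and `b` of the subspace `l` are linearly independent. -/
structure IsFrame (l : Submodule F V) (a b : V) : Prop where
  left_mem : a ∈ l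
  right_mem : b ∈ l
  linearIndependent : LinearIndependent F ![a, b]

lemma finrank_span_pair {a b : V} (h : LinearIndependent F ![a, b]) :
    Module.finrank F (Submodule.span F {a, b}) = 2 := by
  have := finrank_span_eq_card h
  rwa [Matrix.range_cons, Matrix.range_cons, Matrix.range_empty, Set.union_empty,
    Set.singleton_union, Fintype.card_fin] at this

lemma IsFrame.smul_add_ne_zero {l : Submodule F V} {a b : V} (h : IsFrame l a b) (x : F) :
    x • a + b ≠ 0 := by
  intro h0
  have := LinearIndependent.pair_iff.mp h.linearIndependent x 1 (by rwa [one_smul])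
  exact one_ne_zero this.2

lemma IsFrame.exists_eq {l : Submodule F V} {a b : V} (h : IsFrame l a b)
    (hl : Module.finrank F l = 2) {v : V} (hv : v ∈ l) : ∃ x y : F, x • a + y • b = v := by
  have : FiniteDimensional F l := Module.finite_of_finrank_pos (by omega)
  have hspan : Submodule.span F {a, b} = l := by
    refine Submodule.eq_of_le_of_finrank_eq ?_ ?_
    · rw [Submodule.span_le]
      rintro x (rfl | rfl)
      exacts [h.left_mem, h.right_mem]
    · rw [finrank_span_pair h.linearIndependent, hl]
  rwa [← hspan, Submodule.mem_span_pair] at hv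

lemma IsFrame.smul_add {l : Submodule F V} {a b : V} (h : IsFrame l a b) (x : F) :
    IsFrame l (x • a + b) a where
  left_mem := l.add_mem (l.smul_mem x h.left_mem) h.right_mem
  right_mem := h.left_mem
  linearIndependent := by
    rw [LinearIndependent.pair_iff]
    intro s t hst
    have := LinearIndependent.pair_iff.mp h.linearIndependent (s * x + t) s (by
      rw [← hst]
      module)
    refine ⟨this.2, ?_⟩
    simpa [this.2] using this.1

lemma exists_isFrame {l : Submodule F V} (hl : Module.finrank F l = 2) : ∃ a b, IsFrame l a b := by
  have : FiniteDimensional F l := Module.finite_of_finrank_pos (by omega)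
  let B := Module.finBasisOfFinrankEq F l hl
  refine ⟨B 0, B 1, (B 0).2, (B 1).2, ?_⟩
  have hB : LinearIndependent F ![B 0, B 1] := by
    convert B.linearIndependent using 1
    ext i
    fin_cases i <;> rfl
  rw [LinearIndependent.pair_iff] at hB ⊢
  exact fun s t hst => hB s t (Subtype.ext hst)

lemma IsFrame.linearIndependent_of_notMem {l : Submodule F V} {a b w u : V} (h : IsFrame l a b)
    (hu : u ∉ l) (hw : w - u ∈ l) : LinearIndependent F ![a, w] := by
  have ha : a ≠ 0 := h.linearIndependent.ne_zero 0
  rw [LinearIndependent.pair_iff' ha]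
  rintro x rfl
  apply hu
  have := l.sub_mem (l.smul_mem x h.left_mem) hw
  simpa using this

lemma isFrame_span_pair {a b : V} (h : LinearIndependent F ![a, b]) :
    IsFrame (Submodule.span F {a, b}) a b :=
  ⟨Submodule.subset_span (by simp), Submodule.subset_span (by simp), h⟩

end Frames

section Secants

variable {V : Type} [AddCommGroup V] [Module F V] [Fintype F]

/-- The number of points of the affine line through `v` with direction `a` that lie in `S`. -/
def lineCount (F : Type) [Field F] [Fintype F] {V : Type} [AddCommGroup V] [Module F V]
    (S : Set V) (a v : V) : ℕ :=
  (Finset.univ.filter fun x : F => x • a + v ∈ S).card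

/-- The number of projective points of `S` on the line spanned by `a` and `b`. -/
def secantCount (F : Type) [Field F] [Fintype F] {V : Type} [AddCommGroup V] [Module F V]
    (S : Set V) (a b : V) : ℕ :=
  (if a ∈ S then 1 else 0) + lineCount F S a b

/-- The number of elements of `S` in the coset `u + l`. -/
def cosetCount [Fintype V] (S : Set V) (l : Submodule F V) (u : V) : ℕ :=
  (Finset.univ.filter fun v : V => v - u ∈ l ∧ v ∈ S).card

/-- The properties of the cone over the support of a code word used to bound its secants. -/
structure IsCodeCone (F : Type) [Field F] [Fintype F] {V : Type} [AddCommGroup V] [Module F V]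
    (S : Set V) : Prop where
  zero_notMem : (0 : V) ∉ S
  smul_mem_iff : ∀ {t : F}, t ≠ 0 → ∀ v : V, t • v ∈ S ↔ v ∈ S
  card_mul_le : ∀ {a d v : V}, (∀ x y : F, x • a + y • d + v ≠ 0) →
    Fintype.card F * lineCount F S a v ≤
      ∑ y : F, lineCount F S a (y • d + v) + lineCount F S a v * (lineCount F S a v - 1)

lemma IsCodeCone.lineCount_smul {S : Set V} (hS : IsCodeCone F S) {t : F} (ht : t ≠ 0) (a v : V) :
    lineCount F S a (t • v) = lineCount F S a v := by
  refine Finset.card_equiv (Equiv.mulLeft₀ t⁻¹ (inv_ne_zero ht)) fun x => ?_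
  simp only [Finset.mem_filter, Finset.mem_univ, true_and]
  change x • a + t • v ∈ S ↔ (t⁻¹ * x) • a + v ∈ S
  rw [← hS.smul_mem_iff ht ((t⁻¹ * x) • a + v), smul_add, smul_smul, mul_inv_cancel_left₀ ht]

/-- The stability inequality in a plane: the points of the plane outside a line. -/
lemma IsCodeCone.lineCount_add_le {S : Set V} (hS : IsCodeCone F S) {l : Submodule F V}
    {a b u : V} (h : IsFrame l a b) (hu : u ∉ l) (z₀ : F) :
    Fintype.card F * lineCount F S a b + lineCount F S a (z₀ • b + u) ≤
      ∑ z : F, lineCount F S a (z • b + u) + lineCount F S a b * lineCount F S a b := by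
  have hne : ∀ x y : F, x • a + y • (z₀ • b + u) + b ≠ 0 := by
    intro x y h0
    by_cases hy : y = 0
    · rw [hy, zero_smul, add_zero] at h0
      exact h.smul_add_ne_zero x h0
    · apply hu
      have hyu : y • u ∈ l := by
        have h1 : x • a + (y * z₀ + 1) • b ∈ l :=
          l.add_mem (l.smul_mem _ h.left_mem) (l.smul_mem _ h.right_mem)
        have h2 : y • u = -(x • a + (y * z₀ + 1) • b) := by
          rw [eq_neg_iff_add_eq_zero, ← h0]
          module
        rw [h2]
        exact l.neg_mem h1
      exact (l.smul_mem_iff hy).mp hyu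
  have key := hS.card_mul_le hne
  have hsum : ∑ y : F, lineCount F S a (y • (z₀ • b + u) + b) + lineCount F S a (z₀ • b + u) =
      lineCount F S a b + ∑ z : F, lineCount F S a (z • b + u) := by
    have hperm : ∑ z : F, lineCount F S a (z • b + u) =
        ∑ y : F, lineCount F S a ((z₀ + y⁻¹) • b + u) := by
      rw [← Equiv.sum_comp (Equiv.addLeft z₀), ← Equiv.sum_comp (Equiv.inv F)]
      rfl
    rw [hperm, ← Finset.add_sum_erase _ _ (Finset.mem_univ (0 : F)),
      ← Finset.add_sum_erase _ (fun y : F => lineCount F S a ((z₀ + y⁻¹) • b + u))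
        (Finset.mem_univ (0 : F))]
    have : ∀ y ∈ Finset.univ.erase (0 : F), lineCount F S a (y • (z₀ • b + u) + b) =
        lineCount F S a ((z₀ + y⁻¹) • b + u) := by
      intro y hy
      have hy : y ≠ 0 := Finset.ne_of_mem_erase hy
      rw [← hS.lineCount_smul hy a ((z₀ + y⁻¹) • b + u)]
      congr 1
      rw [_root_.smul_add, _root_.smul_add, smul_smul, smul_smul, mul_add, mul_inv_cancel₀ hy]
      module
    rw [Finset.sum_congr rfl this]
    simp only [zero_smul, zero_add, inv_zero, add_zero]
    ring
  rcases Nat.eq_zero_or_pos (lineCount F S a b) with h0 | h0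
  · rw [h0] at hsum key ⊢
    omega
  · obtain ⟨m, hm⟩ := Nat.exists_eq_add_of_lt h0
    simp only [hm, zero_add, Nat.add_sub_cancel] at key hsum ⊢
    nlinarith

/-- A lower bound for the weight of a plane in terms of one of its secants. -/
lemma IsCodeCone.mul_le_sum_lineCount {S : Set V} (hS : IsCodeCone F S) {l : Submodule F V}
    {a b u : V} (h : IsFrame l a b) (hu : u ∉ l) {k m : ℕ}
    (hm : m + lineCount F S a b * lineCount F S a b ≤ Fintype.card F * lineCount F S a b)
    (hkm : k * Fintype.card F < m) :
    m + (k + 1) ≤ ∑ z : F, lineCount F S a (z • b + u) := by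
  obtain ⟨z, hz⟩ : ∃ z : F, k < lineCount F S a (z • b + u) := by
    by_contra! hle
    have h1 := Finset.sum_le_sum fun z (_ : z ∈ Finset.univ) => hle z
    rw [Finset.sum_const, Finset.card_univ, smul_eq_mul] at h1
    have := hS.lineCount_add_le h hu 0
    nlinarith
  have := hS.lineCount_add_le h hu z
  omega

lemma IsFrame.cosetCount_eq [Fintype V] {l : Submodule F V} {a b : V} (h : IsFrame l a b)
    (hl : Module.finrank F l = 2) (S : Set V) (u : V) :
    cosetCount S l u = ∑ z : F, lineCount F S a (z • b + u) := by
  simp only [cosetCount, lineCount]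
  rw [← Finset.card_sigma]
  symm
  refine Finset.card_bij (fun t _ => t.2 • a + (t.1 • b + u)) ?_ ?_ ?_
  · rintro ⟨z, x⟩ ht
    simp only [Finset.mem_sigma, Finset.mem_filter, Finset.mem_univ, true_and] at ht ⊢
    refine ⟨?_, ht⟩
    rw [← add_assoc, add_sub_cancel_right]
    exact l.add_mem (l.smul_mem _ h.left_mem) (l.smul_mem _ h.right_mem)
  · rintro ⟨z, x⟩ _ ⟨z', x'⟩ _ heq
    dsimp only at heq
    have := LinearIndependent.pair_iff.mp h.linearIndependent (x - x') (z - z') (by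
      rw [← sub_eq_zero] at heq
      rw [← heq]
      module)
    rw [sub_eq_zero.mp this.1, sub_eq_zero.mp this.2]
  · intro v hv
    simp only [Finset.mem_filter, Finset.mem_univ, true_and] at hv
    obtain ⟨x, y, hxy⟩ := h.exists_eq hl hv.1
    have hv' : x • a + (y • b + u) = v := by rw [← add_assoc, hxy, sub_add_cancel]
    refine ⟨⟨y, x⟩, ?_, hv'⟩
    simp only [Finset.mem_sigma, Finset.mem_filter, Finset.mem_univ, true_and, hv', hv.2]

lemma IsCodeCone.card_filter_mem {S : Set V} [Fintype V] (hS : IsCodeCone F S)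
    {l : Submodule F V} (hl : Module.finrank F l = 2) {a b : V} (h : IsFrame l a b) :
    (Finset.univ.filter fun v : V => v ∈ l ∧ v ∈ S).card =
      (Fintype.card F - 1) * secantCount F S a b := by
  have h1 := h.cosetCount_eq hl S 0
  simp only [cosetCount, sub_zero, add_zero] at h1
  rw [h1, ← Finset.add_sum_erase _ _ (Finset.mem_univ (0 : F)), secantCount, mul_add]
  congr 1
  · rw [zero_smul, lineCount]
    simp only [add_zero]
    have hx : ∀ x : F, x • a ∈ S ↔ x ≠ 0 ∧ a ∈ S := by
      intro x
      by_cases hx : x = 0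
      · simp [hx, hS.zero_notMem]
      · simp [hx, hS.smul_mem_iff hx]
    simp only [hx]
    split_ifs with ha
    · simp only [ha, and_true, mul_one]
      rw [Finset.filter_ne' Finset.univ (0 : F), Finset.card_erase_of_mem (Finset.mem_univ _),
        Finset.card_univ]
    · simp [ha]
  · rw [Finset.sum_congr rfl fun z hz => hS.lineCount_smul (Finset.ne_of_mem_erase hz) a b,
      Finset.sum_const, Finset.card_erase_of_mem (Finset.mem_univ _), Finset.card_univ, smul_eq_mul]

lemma IsCodeCone.secantCount_eq {S : Set V} [Fintype V] (hS : IsCodeCone F S)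
    {l : Submodule F V} (hl : Module.finrank F l = 2) {a b a' b' : V} (h : IsFrame l a b)
    (h' : IsFrame l a' b') : secantCount F S a b = secantCount F S a' b' := by
  have h1 := (hS.card_filter_mem hl h).symm.trans (hS.card_filter_mem hl h')
  have := Fintype.one_lt_card (α := F)
  exact Nat.eq_of_mul_eq_mul_left (by omega) h1

lemma IsCodeCone.exists_frame_notMem {S : Set V} [Fintype V] (hS : IsCodeCone F S)
    {l : Submodule F V} (hl : Module.finrank F l = 2) {a b : V} (h : IsFrame l a b)
    (hle : secantCount F S a b ≤ Fintype.card F) :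
    ∃ a' b', IsFrame l a' b' ∧ lineCount F S a' b' = secantCount F S a b := by
  by_cases ha : a ∈ S
  · obtain ⟨x, hx⟩ : ∃ x : F, x • a + b ∉ S := by
      by_contra! hall
      have : lineCount F S a b = Fintype.card F := by
        rw [lineCount, Finset.filter_true_of_mem fun x _ => hall x, Finset.card_univ]
      rw [secantCount, if_pos ha] at hle
      omega
    refine ⟨_, _, h.smul_add x, ?_⟩
    rw [hS.secantCount_eq hl h (h.smul_add x), secantCount, if_neg hx, zero_add]
  · exact ⟨a, b, h, by rw [secantCount, if_neg ha, zero_add]⟩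

lemma IsCodeCone.exists_frame_mem {S : Set V} [Fintype V] (hS : IsCodeCone F S)
    {l : Submodule F V} (hl : Module.finrank F l = 2) {a b : V} (h : IsFrame l a b)
    (hpos : 0 < secantCount F S a b) :
    ∃ a' b', IsFrame l a' b' ∧ a' ∈ S ∧ lineCount F S a' b' + 1 = secantCount F S a b := by
  by_cases ha : a ∈ S
  · exact ⟨a, b, h, ha, by rw [secantCount, if_pos ha, add_comm]⟩
  · obtain ⟨x, hx⟩ : ∃ x : F, x • a + b ∈ S := by
      rw [secantCount, if_neg ha, zero_add, lineCount, Finset.card_pos] at hpos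
      obtain ⟨x, hx⟩ := hpos
      exact ⟨x, (Finset.mem_filter.mp hx).2⟩
    refine ⟨_, _, h.smul_add x, hx, ?_⟩
    rw [hS.secantCount_eq hl h (h.smul_add x), secantCount, if_pos hx, add_comm]

end Secants

section Bounds

lemma mul_card_le_card_biUnion_add_choose {ι α : Type} {s : Finset ι} {T : ι → Finset α} {k : ℕ}
    (hk : ∀ i ∈ s, k ≤ (T i).card)
    (hT : ∀ i ∈ s, ∀ j ∈ s, i ≠ j → (T i ∩ T j).card ≤ 1) :
    s.card * k ≤ (s.biUnion T).card + s.card.choose 2 := by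
  induction s using Finset.induction_on with
  | empty => simp
  | insert a s ha ih =>
    have h1 := ih (fun i hi => hk i (Finset.mem_insert_of_mem hi)) fun i hi j hj =>
      hT i (Finset.mem_insert_of_mem hi) j (Finset.mem_insert_of_mem hj)
    have h2 := hk a (Finset.mem_insert_self a s)
    have h3 : (T a ∩ s.biUnion T).card ≤ s.card := by
      rw [Finset.inter_biUnion]
      refine Finset.card_biUnion_le.trans ((Finset.sum_le_card_nsmul s _ 1 fun i hi => ?_).trans ?_)
      · exact hT a (Finset.mem_insert_self a s) i (Finset.mem_insert_of_mem hi)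
          (ne_of_mem_of_not_mem hi ha).symm
      · simp
    have h4 := Finset.card_union_add_card_inter (T a) (s.biUnion T)
    rw [Finset.biUnion_insert, Finset.card_insert_of_notMem ha, Nat.choose_succ_succ' s.card 1,
      Nat.choose_one_right, one_add_one_eq_two, add_mul, one_mul]
    omega

variable {V : Type} [AddCommGroup V] [Module F V] [Fintype V]

/-- Double counting the pairs of vectors outside `l` that lie in the same coset of `l`. -/
lemma card_mul_le_of_le_cosetCount {S : Set V} {l : Submodule F V} {K : ℕ}
    (hK : ∀ u ∉ l, K ≤ cosetCount S l u) :
    (Finset.univ.filter fun v : V => v ∉ l).card * K ≤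
      (Finset.univ.filter fun v : V => v ∉ l ∧ v ∈ S).card *
        (Finset.univ.filter fun v : V => v ∈ l).card := by
  refine Finset.card_mul_le_card_mul (fun u v => v - u ∈ l) (fun u hu => ?_) fun v _ => ?_
  · have hu : u ∉ l := (Finset.mem_filter.mp hu).2
    refine (hK u hu).trans (Finset.card_le_card fun v hv => ?_)
    simp only [Finset.mem_filter, Finset.mem_univ, true_and, Finset.mem_bipartiteAbove] at hv ⊢
    refine ⟨⟨fun hvl => hu ?_, hv.2⟩, hv.1⟩
    have := l.sub_mem hvl hv.1
    rwa [sub_sub_cancel] at this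
  · refine Finset.card_le_card_of_injOn (fun u => v - u) (fun u hu => ?_) fun u _ u' _ huu' =>
      sub_right_injective huu'
    have := ((Finset.mem_bipartiteBelow (r := fun u v => v - u ∈ l)).mp hu).2
    simpa using this

variable [Fintype F]

lemma IsCodeCone.le_cosetCount {S : Set V} (hS : IsCodeCone F S) {l : Submodule F V}
    (hl : Module.finrank F l = 2) {a b u : V} (h : IsFrame l a b) (hu : u ∉ l)
    (hq : 11 ≤ Fintype.card F) (h3 : 3 ≤ secantCount F S a b)
    (hle : secantCount F S a b ≤ Fintype.card F - 2) :
    3 * Fintype.card F - 6 ≤ cosetCount S l u := by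
  obtain ⟨a', b', h', h3', hle'⟩ : ∃ a' b', IsFrame l a' b' ∧ 3 ≤ lineCount F S a' b' ∧
      lineCount F S a' b' + 3 ≤ Fintype.card F := by
    by_cases hα : secantCount F S a b = Fintype.card F - 2
    · obtain ⟨a', b', h', -, hc⟩ := hS.exists_frame_mem hl h (by omega)
      exact ⟨a', b', h', by omega, by omega⟩
    · obtain ⟨a', b', h', hc⟩ := hS.exists_frame_notMem hl h (by omega)
      exact ⟨a', b', h', by omega, by omega⟩
  rw [h'.cosetCount_eq hl]
  obtain ⟨d, hd⟩ := Nat.exists_eq_add_of_le hle'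
  obtain ⟨e, he⟩ := Nat.exists_eq_add_of_le h3'
  have := hS.mul_le_sum_lineCount h' hu (k := 2) (m := 3 * (Fintype.card F - 3))
    (by rw [hd, show lineCount F S a' b' + 3 + d - 3 = lineCount F S a' b' + d by omega, he]
        ring_nf
        nlinarith) (by omega)
  omega

lemma IsCodeCone.le_cosetCount_of_card_eq_seven {S : Set V} (hS : IsCodeCone F S)
    {l : Submodule F V} (hl : Module.finrank F l = 2) {a b u : V} (h : IsFrame l a b) (hu : u ∉ l)
    (hq : Fintype.card F = 7) (h3 : 3 ≤ secantCount F S a b) (hle : secantCount F S a b ≤ 5) :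
    14 ≤ cosetCount S l u := by
  obtain ⟨a', b', h', hcard⟩ : ∃ a' b', IsFrame l a' b' ∧
      (lineCount F S a' b' = 3 ∨ lineCount F S a' b' = 4) := by
    by_cases hα : secantCount F S a b = 5
    · obtain ⟨a', b', h', -, hc⟩ := hS.exists_frame_mem hl h (by omega)
      exact ⟨a', b', h', by omega⟩
    · obtain ⟨a', b', h', hc⟩ := hS.exists_frame_notMem hl h (by omega)
      exact ⟨a', b', h', by omega⟩
  rw [h'.cosetCount_eq hl]
  exact hS.mul_le_sum_lineCount h' hu (k := 1) (m := 12)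
    (by rcases hcard with hc | hc <;> rw [hc, hq]) (by omega)

/-- If every line meets the support in at most `2` or at least `q - 1` points, then a
`(q - 1)`-secant forces many points in each plane through it. -/
lemma IsCodeCone.le_cosetCount_of_secantCount_eq {S : Set V} (hS : IsCodeCone F S)
    {l : Submodule F V} (hl : Module.finrank F l = 2) {a b u : V} (h : IsFrame l a b) (hu : u ∉ l)
    (hq : 7 ≤ Fintype.card F) (hα : secantCount F S a b = Fintype.card F - 1)
    (hsec : ∀ a b : V, LinearIndependent F ![a, b] →
      secantCount F S a b ≤ 2 ∨ Fintype.card F - 1 ≤ secantCount F S a b) :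
    3 * Fintype.card F - 6 ≤ cosetCount S l u := by
  obtain ⟨a, b, h, -, hc⟩ := hS.exists_frame_mem hl h (by omega)
  obtain ⟨r, hr⟩ := Nat.exists_eq_add_of_le hq
  have hA : 2 * Fintype.card F - 2 ≤ cosetCount S l u := by
    rw [h.cosetCount_eq hl]
    have := hS.mul_le_sum_lineCount h hu (k := 1) (m := 2 * (Fintype.card F - 2))
      (by rw [show lineCount F S a b = r + 5 by omega, hr, show 7 + r - 2 = r + 5 by omega]
          ring_nf
          omega) (by omega)
    omega
  have hw : ∀ x : F, x • a + b ∈ S →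
      ∃ w, w - u ∈ l ∧ Fintype.card F - 2 ≤ lineCount F S (x • a + b) w := by
    intro x hx
    have hf := h.smul_add x
    rw [hf.cosetCount_eq hl] at hA
    obtain ⟨z, -, hz⟩ : ∃ z ∈ (Finset.univ : Finset F),
        1 < lineCount F S (x • a + b) (z • a + u) := by
      refine Finset.exists_lt_of_sum_lt ?_
      rw [Finset.sum_const, Finset.card_univ, smul_eq_mul]
      omega
    have hzl : z • a + u - u ∈ l := by
      rw [add_sub_cancel_right]
      exact l.smul_mem z h.left_mem
    refine ⟨_, hzl, ?_⟩
    have := hsec _ _ (hf.linearIndependent_of_notMem hu hzl)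
    rw [secantCount, if_pos hx] at this
    omega
  choose! w hwl hwc using hw
  obtain ⟨Y, hYX, hY⟩ := Finset.exists_subset_card_eq
    (s := Finset.univ.filter fun x : F => x • a + b ∈ S) (n := 5) (by
      change 5 ≤ lineCount F S a b
      omega)
  let T : F → Finset V := fun x =>
    (Finset.univ.filter fun t : F => t • (x • a + b) + w x ∈ S).image fun t => t • (x • a + b) + w x
  have hT : ∀ x ∈ Y, Fintype.card F - 2 ≤ (T x).card := by
    intro x hx
    rw [Finset.card_image_of_injective _ fun t t' htt' =>
      smul_left_injective F (h.smul_add_ne_zero x) (add_right_cancel htt')]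
    exact hwc x (Finset.mem_filter.mp (hYX hx)).2
  have hTT : ∀ x ∈ Y, ∀ y ∈ Y, x ≠ y → (T x ∩ T y).card ≤ 1 := by
    intro x _ y _ hxy
    rw [Finset.card_le_one]
    intro v hv v' hv'
    simp only [T, Finset.mem_inter, Finset.mem_image] at hv hv'
    obtain ⟨⟨t, -, rfl⟩, s, -, hs⟩ := hv
    obtain ⟨⟨t', -, rfl⟩, s', -, hs'⟩ := hv'
    have hli := LinearIndependent.pair_iff.mp h.linearIndependent
      ((t - t') * x - (s - s') * y) ((t - t') - (s - s')) (by
        have h0 : (t • (x • a + b) + w x - (t' • (x • a + b) + w x)) -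
            (s • (y • a + b) + w y - (s' • (y • a + b) + w y)) = 0 := by
          rw [hs, hs', sub_self]
        rw [← h0]
        module)
    have htt : (t - t') * (x - y) = 0 := by linear_combination hli.1 - y * hli.2
    rw [sub_eq_zero.mp ((mul_eq_zero.mp htt).resolve_right (sub_ne_zero.mpr hxy))]
  have hsub : Y.biUnion T ⊆ Finset.univ.filter fun v : V => v - u ∈ l ∧ v ∈ S := by
    intro v hv
    simp only [T, Finset.mem_biUnion, Finset.mem_image, Finset.mem_filter, Finset.mem_univ,
      true_and] at hv ⊢
    obtain ⟨x, hx, t, ht, rfl⟩ := hv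
    refine ⟨?_, ht⟩
    rw [add_sub_assoc]
    exact l.add_mem (l.smul_mem t (h.smul_add x).left_mem) (hwl x (Finset.mem_filter.mp (hYX hx)).2)
  have h1 := mul_card_le_card_biUnion_add_choose hT hTT
  have h2 : (Y.biUnion T).card ≤ cosetCount S l u := Finset.card_le_card hsub
  rw [hY, show Nat.choose 5 2 = 10 by rfl] at h1
  omega

end Bounds

section CodeWords

lemma theta_mul_add {q : ℕ} (hq : 1 ≤ q) (k : ℕ) :
    theta q k * (q - 1) + 1 = q ^ (k + 1) := by
  obtain ⟨r, rfl⟩ := Nat.exists_eq_add_of_le' hq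
  rw [theta, if_neg (by omega), Int.toNat_natCast, Nat.add_sub_cancel]
  exact geom_sum_mul_add r (k + 1)

lemma B_seven_lt (k : ℕ) : B (2 + k) 7 < 14 * theta 7 k + 3 := by
  have hθ : (theta 7 k : ℝ) * 6 + 1 = 7 ^ (k + 1) := by
    exact_mod_cast theta_mul_add (q := 7) (by norm_num) k
  have hsqrt : (6.4 : ℝ) ≤ Real.sqrt (6 * (7 : ℕ)) := Real.le_sqrt_of_sq_le (by norm_num)
  have hpow : (0 : ℝ) < 7 ^ k := by positivity
  rw [B, if_neg (by norm_num), if_pos (by norm_num), Nat.add_sub_cancel_left]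
  push_cast at hsqrt ⊢
  rw [pow_succ] at hθ
  nlinarith

variable [Fintype F] {n p : ℕ}

lemma isCodeCone_suppCone [Fact p.Prime] [CharP F p] {c : Pt F n → ZMod p} (hc : c ∈ code F p n) :
    IsCodeCone F (suppCone c) where
  zero_notMem := fun h => h (vecFun_zero c)
  smul_mem_iff ht v := by
    rw [mem_suppCone, mem_suppCone, vecFun_smul c ht]
  card_mul_le {a d v} h := by
    have hs : ∀ y : F, lineCount F (suppCone c) a (y • d + v) =
        (Finset.univ.filter fun x : F =>
          ZMod.castHom (dvd_refl p) F (vecFun c (x • a + y • d + v)) ≠ 0).card := by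
      intro y
      rw [lineCount]
      congr 1
      ext x
      simp only [Finset.mem_filter, Finset.mem_univ, true_and]
      rw [map_ne_zero, add_assoc, mem_suppCone]
    have := card_mul_le_sum_of_moments
      (fun x y => ZMod.castHom (dvd_refl p) F (vecFun c (x • a + y • d + v)))
      (exists_moment_polynomial hc h) (fun y => lineCount F (suppCone c) a (y • d + v)) hs 0
    simpa only [zero_smul, zero_add] using this

lemma secantCount_suppCone [Fact p.Prime] [CharP F p] {c : Pt F n → ZMod p} (hc : c ∈ code F p n)
    {l : Submodule F (Fin (n + 1) → F)} (hl : IsLine l) {a b : Fin (n + 1) → F}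
    (h : IsFrame l a b) :
    secantCount F (suppCone c) a b = (ptsIn l ∩ supp c).ncard := by
  have h1 := ((isCodeCone_suppCone hc).card_filter_mem hl h).symm.trans
    (card_filter_mem_suppCone c l)
  have := Fintype.one_lt_card (α := F)
  exact Nat.eq_of_mul_eq_mul_left (by omega) h1

/-- If every plane through a line `l` contains at least `K` points of `supp c` outside `l`, then
the weight of `c` is large. -/
lemma add_mul_theta_le_wt (hn : 2 ≤ n) (c : Pt F n → ZMod p)
    {l : Submodule F (Fin (n + 1) → F)} (hl : IsLine l) {K : ℕ}
    (hK : ∀ u ∉ l, K ≤ cosetCount (suppCone c) l u) :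
    (ptsIn l ∩ supp c).ncard + K * theta (Fintype.card F) ((n : ℤ) - 2) ≤ wt c := by
  obtain ⟨k, rfl⟩ := Nat.exists_eq_add_of_le hn
  have hq : 0 < Fintype.card F - 1 := Nat.sub_pos_of_lt Fintype.one_lt_card
  have hθ : theta (Fintype.card F) (((2 + k : ℕ) : ℤ) - 2) * (Fintype.card F - 1) + 1 =
      Fintype.card F ^ (k + 1) := by
    rw [show ((2 + k : ℕ) : ℤ) - 2 = k by omega]
    exact theta_mul_add (by omega) k
  have hcount := card_mul_le_of_le_cosetCount hK
  have hlcard : (Finset.univ.filter fun v => v ∈ l).card = Fintype.card F ^ 2 := by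
    have := Module.card_eq_pow_finrank (K := F) (V := l)
    rw [show Module.finrank F l = 2 from hl] at this
    rw [← this]
    exact (Fintype.card_subtype _).symm
  have hVcard := Finset.card_filter_add_card_filter_not (s := Finset.univ)
    fun v : Fin (2 + k + 1) → F => v ∈ l
  have hl1 := card_filter_mem_suppCone c l
  have hV1 := card_filter_mem_suppCone c ⊤
  have hwt : (ptsIn (⊤ : Submodule F (Fin (2 + k + 1) → F)) ∩ supp c).ncard = wt c := by
    rw [wt]
    congr 1
    exact Set.inter_eq_right.mpr fun P _ => (le_top : Projectivization.submodule P ≤ ⊤)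
  have hsplit := Finset.card_filter_add_card_filter_not
    (s := Finset.univ.filter fun v : Fin (2 + k + 1) → F => v ∈ suppCone c) fun v => v ∈ l
  simp only [Finset.filter_filter, Submodule.mem_top, true_and] at hsplit hV1
  simp only [and_comm (b := _ ∈ l), and_comm (b := _ ∉ l)] at hsplit
  rw [hl1, hV1, hwt] at hsplit
  rw [hlcard, Finset.card_univ, Fintype.card_fun, Fintype.card_fin] at hVcard
  rw [hlcard] at hcount
  set N := (Finset.univ.filter fun v => v ∉ l ∧ v ∈ suppCone c).card
  set M := (Finset.univ.filter fun v => v ∉ l).card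
  set θ := theta (Fintype.card F) (((2 + k : ℕ) : ℤ) - 2)
  set q := Fintype.card F
  have hM : M = q ^ 2 * (θ * (q - 1)) := by
    have : q ^ (2 + k + 1) = q ^ 2 * (θ * (q - 1) + 1) := by
      rw [hθ]
      ring
    rw [this] at hVcard
    linarith
  have hN : θ * (q - 1) * K ≤ N := by
    refine le_of_mul_le_mul_left (a := q ^ 2) ?_ (Nat.pow_pos (by omega))
    calc q ^ 2 * (θ * (q - 1) * K) = M * K := by rw [hM]; ring
      _ ≤ N * q ^ 2 := hcount
      _ = q ^ 2 * N := mul_comm _ _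
  refine le_of_mul_le_mul_left (a := q - 1) ?_ hq
  nlinarith

end CodeWords

/-- Lemma 15 of the paper: for a code word of weight at most
`min {(3q-6)θ_{n-2}+2, B_{n,q}}`, every line meets `supp c` in at most `2` or at least `q`
points. -/
theorem statement6 [Fintype F] {p h q n : ℕ} [Fact p.Prime] (hh : 1 ≤ h) (hq : q = p ^ h)
    (hF : Fintype.card F = q) (hq7 : 7 ≤ q)
    (hqex : q ∉ ({8, 9, 16, 25, 27, 49} : Set ℕ)) (hn : 2 ≤ n)
    (c : Pt F n → ZMod p) (hc : c ∈ code F p n)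
    (hwt : (wt c : ℝ) ≤ min ((3 * (q : ℝ) - 6) * (theta q ((n : ℤ) - 2) : ℝ) + 2) (B n q)) :
    ∀ l : Submodule F (Fin (n + 1) → F), IsLine l →
      (ptsIn l ∩ supp c).ncard ≤ 2 ∨ q ≤ (ptsIn l ∩ supp c).ncard := by
  subst hF
  obtain ⟨k, rfl⟩ := Nat.exists_eq_add_of_le hn
  have : CharP F p := charP_of_card_eq_prime_pow hq
  obtain ⟨hwt₁, hwt₂⟩ := le_min_iff.mp hwt
  have hS := isCodeCone_suppCone hc
  have hθ : ((2 + k : ℕ) : ℤ) - 2 = k := by omega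
  rw [hθ] at hwt₁
  have hwt_le : wt c ≤ (3 * Fintype.card F - 6) * theta (Fintype.card F) k + 2 := by
    have h6 : ((3 * Fintype.card F - 6 : ℕ) : ℝ) = 3 * (Fintype.card F : ℝ) - 6 := by
      rw [Nat.cast_sub (by omega)]
      norm_num
    rw [← h6] at hwt₁
    exact_mod_cast hwt₁
  have hcoset : ∀ (l : Submodule F (Fin (2 + k + 1) → F)), IsLine l →
      3 ≤ (ptsIn l ∩ supp c).ncard →
      ¬ ∀ u ∉ l, 3 * Fintype.card F - 6 ≤ cosetCount (suppCone c) l u := by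
    intro l hl h3 hK
    have := add_mul_theta_le_wt hn c hl hK
    rw [hθ] at this
    omega
  have hcard : Fintype.card F = 7 ∨ 11 ≤ Fintype.card F := by
    have h10 : Fintype.card F ≠ 10 := by
      intro h10
      have h2 : p = 2 := ((Nat.prime_dvd_prime_iff_eq Nat.prime_two Fact.out).mp
        (Nat.prime_two.dvd_of_dvd_pow (n := h) (by rw [← hq, h10]; norm_num))).symm
      have h5 : p = 5 := ((Nat.prime_dvd_prime_iff_eq Nat.prime_five Fact.out).mp
        (Nat.prime_five.dvd_of_dvd_pow (n := h) (by rw [← hq, h10]; norm_num))).symm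
      omega
    simp only [Set.mem_insert_iff, Set.mem_singleton_iff, not_or] at hqex
    omega
  have hsec : ∀ a b : Fin (2 + k + 1) → F, LinearIndependent F ![a, b] →
      secantCount F (suppCone c) a b ≤ 2 ∨
        Fintype.card F - 1 ≤ secantCount F (suppCone c) a b := by
    intro a b hab
    by_contra! hlt
    have h := isFrame_span_pair hab
    have hl := finrank_span_pair hab
    have hα := secantCount_suppCone hc hl h
    rcases hcard with h7 | h11
    · have := add_mul_theta_le_wt hn c hl fun u hu =>
        hS.le_cosetCount_of_card_eq_seven hl h hu h7 (by omega) (by omega)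
      have hB := B_seven_lt k
      rw [h7] at this hwt₂
      rw [hθ] at this
      have h17 : 14 * theta 7 k + 3 ≤ wt c := by omega
      have : (14 * theta 7 k + 3 : ℝ) ≤ wt c := by exact_mod_cast h17
      linarith
    · exact hcoset _ hl (by omega) fun u hu => hS.le_cosetCount hl h hu h11 (by omega) (by omega)
  intro l hl
  by_contra! hlt
  obtain ⟨a, b, h⟩ := exists_isFrame hl
  have hα := secantCount_suppCone hc hl h
  have := hsec a b h.linearIndependent
  exact hcoset l hl (by omega) fun u hu =>
    hS.le_cosetCount_of_secantCount_eq hl h hu hq7 (by omega) hsec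

end PGCode
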